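/- Let I = {i_1 < i_2 < ⋯ < i_l} be a nonempty finite set of positive integers with m = i_l. Then the descent polynomials satisfy, as polynomials in n: d(I,n+1) = d(I,n) + Σ_{i_t ∈ I''∖{m}} d(I_t, n) + Σ_{i_t ∈ I'∖{m}} d(Î_t, n) + d(I⁻, m−1)·C(n, m−1), where the sums run over those indices t with i_t in I''∖{m}, respectively I'∖{m}. -/

import Mathlib

/-- The descent set of a permutation of `{1,…,n}` (modeled on `Fin n`), as a set of
1-indexed positions `i ∈ {1, …, n-1}` with `π_i > π_{i+1}`. -/
noncomputable def descSet (n : ℕ) (π : Equiv.Perm (Fin n)) : Finset ℕ :=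
  @Finset.filter _
    (fun i => ∃ (h1 : i - 1 < n) (h2 : i < n), π ⟨i, h2⟩ < π ⟨i - 1, h1⟩)
    (Classical.decPred _) (Finset.Ioo 0 n)

/-- `dCount I n` is the number of permutations of `{1,…,n}` with descent set `I`. -/
noncomputable def dCount (I : Finset ℕ) (n : ℕ) : ℕ :=
  Nat.card {π : Equiv.Perm (Fin n) // descSet n π = I}

/-- `mI I = max (I ∪ {0})`. -/
def mI (I : Finset ℕ) : ℕ := I.sup id

/-- `I⁻ = I \ {max I}`. -/
def Isub (I : Finset ℕ) : Finset ℕ := I.erase (mI I)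

/-- For `a = i_t ∈ I`, `Imod I a` is the set
`I_t = {i_1,…,i_{t−1}, i_t−1, i_{t+1}−1, …, i_l−1} \ {0}`. -/
def Imod (I : Finset ℕ) (a : ℕ) : Finset ℕ :=
  ((I.filter (fun x => x < a)) ∪ ((I.filter (fun x => a ≤ x)).image (fun x => x - 1))).erase 0

/-- For `a = i_t ∈ I`, `Ihat I a` is the set
`Î_t = {i_1,…,i_{t−1}, i_{t+1}−1, …, i_l−1}`. -/
def Ihat (I : Finset ℕ) (a : ℕ) : Finset ℕ :=
  (I.filter (fun x => x < a)) ∪ ((I.filter (fun x => a < x)).image (fun x => x - 1))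

/-- `I' = {i ∈ I : i − 1 ∉ I}`. -/
def Iprime (I : Finset ℕ) : Finset ℕ := I.filter (fun a => a - 1 ∉ I)

/-- `I'' = I' \ {1}`. -/
def Iprime2 (I : Finset ℕ) : Finset ℕ := (Iprime I).erase 1

lemma desc_zero (n : ℕ) (π : Equiv.Perm (Fin n)) : 0 ∉ descSet n π := by
  simp [descSet]

lemma desc_lt (n : ℕ) (π : Equiv.Perm (Fin n)) (x : ℕ) (h : x ∈ descSet n π) : x < n := by
  simp [descSet] at h; omega

lemma desc_succ (n : ℕ) (π : Equiv.Perm (Fin n)) (i : ℕ) :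
    i + 1 ∈ descSet n π ↔ ∃ h : i + 1 < n, π ⟨i + 1, h⟩ < π ⟨i, by omega⟩ := by
  simp only [descSet, Finset.mem_filter, Finset.mem_Ioo, Nat.add_sub_cancel]
  constructor
  · rintro ⟨_, _, h2, h⟩
    exact ⟨h2, h⟩
  · rintro ⟨h2, h⟩
    exact ⟨⟨by omega, h2⟩, by omega, h2, h⟩

/-- Insert the maximum at position `p`. -/
def insMax {n : ℕ} (p : Fin (n + 1)) (σ : Equiv.Perm (Fin n)) : Equiv.Perm (Fin (n + 1)) :=
  (finSuccEquiv' p).trans ((Equiv.optionCongr σ).trans (finSuccEquiv' (Fin.last n)).symm)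

lemma insMax_self {n : ℕ} (p : Fin (n + 1)) (σ : Equiv.Perm (Fin n)) :
    insMax p σ p = Fin.last n := by
  simp [insMax]

lemma insMax_above {n : ℕ} (p : Fin (n + 1)) (σ : Equiv.Perm (Fin n)) (i : Fin n) :
    insMax p σ (p.succAbove i) = (σ i).castSucc := by
  simp [insMax]

lemma insMax_lt {n : ℕ} (p : Fin (n + 1)) (σ : Equiv.Perm (Fin n)) (i : ℕ) (h : i < p.1)
    (h1 : i < n + 1) (h2 : i < n) :
    insMax p σ ⟨i, h1⟩ = (σ ⟨i, h2⟩).castSucc := by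
  rw [← insMax_above p]
  congr 1
  rw [Fin.succAbove_of_castSucc_lt]
  · rfl
  · exact h

lemma insMax_gt {n : ℕ} (p : Fin (n + 1)) (σ : Equiv.Perm (Fin n)) (i : ℕ) (h : p.1 ≤ i)
    (h1 : i + 1 < n + 1) (h2 : i < n) :
    insMax p σ ⟨i + 1, h1⟩ = (σ ⟨i, h2⟩).castSucc := by
  rw [← insMax_above p]
  congr 1
  rw [Fin.succAbove_of_le_castSucc]
  · rfl
  · exact h

lemma insMax_bij (n : ℕ) :
    Function.Bijective (fun q : Fin (n + 1) × Equiv.Perm (Fin n) => insMax q.1 q.2) := by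
  rw [Fintype.bijective_iff_injective_and_card]
  constructor
  · rintro ⟨p, σ⟩ ⟨q, τ⟩ h
    simp only at h
    have hp : p = q := by
      apply (insMax p σ).injective
      rw [insMax_self, h, insMax_self]
    subst hp
    have : σ = τ := by
      ext i
      have h1 := insMax_above p σ i
      rw [h, insMax_above] at h1
      have := congrArg Fin.val h1
      simpa using this.symm
    rw [this]
  · simp [Fintype.card_perm, Nat.factorial_succ]

lemma desc_insMax {n : ℕ} (p : Fin (n + 1)) (σ : Equiv.Perm (Fin n)) (x : ℕ) :
    x ∈ descSet (n + 1) (insMax p σ) ↔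
      (x < p.1 ∧ x ∈ descSet n σ) ∨ (x = p.1 + 1 ∧ p.1 < n) ∨
        (p.1 + 1 < x ∧ x - 1 ∈ descSet n σ) := by
  obtain _ | i := x
  · simp [desc_zero]
  rw [desc_succ]
  have hp := p.2
  rcases lt_trichotomy i p.1 with h | h | h
  · by_cases h' : i + 1 = p.1
    · have : ¬ ∃ h : i + 1 < n + 1, insMax p σ ⟨i + 1, h⟩ < insMax p σ ⟨i, by omega⟩ := by
        rintro ⟨h1, h2⟩
        have e : (⟨i + 1, h1⟩ : Fin (n + 1)) = p := Fin.ext h'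
        rw [e, insMax_self] at h2
        exact absurd h2 (not_lt.mpr (Fin.le_last _))
      simp only [this, false_iff]
      omega
    · have : ¬ (i + 1 = p.1 + 1 ∧ p.1 < n) := by omega
      have h3 : ¬ (p.1 + 1 < i + 1 ∧ i + 1 - 1 ∈ descSet n σ) := by omega
      simp only [this, h3, or_false]
      rw [desc_succ]
      have h4 : i + 1 < p.1 := by omega
      simp only [h4, true_and]
      have h5 : i + 1 < n := by omega
      constructor
      · rintro ⟨h1, h2⟩
        rw [insMax_lt p σ (i+1) h4 (by omega) (by omega),
          insMax_lt p σ i h (by omega) (by omega)] at h2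
        exact ⟨h5, h2⟩
      · rintro ⟨h1, h2⟩
        refine ⟨by omega, ?_⟩
        rw [insMax_lt p σ (i+1) h4 (by omega) (by omega),
          insMax_lt p σ i h (by omega) (by omega)]
        exact h2
  · subst h
    have h3 : ¬ (p.1 + 1 < p.1 + 1 ∧ p.1 + 1 - 1 ∈ descSet n σ) := by omega
    have h4 : ¬ (p.1 + 1 < p.1 ∧ p.1 + 1 ∈ descSet n σ) := by omega
    simp only [h3, h4, or_false, false_or, true_and]
    constructor
    · rintro ⟨h1, h2⟩
      omega
    · intro h1
      refine ⟨by omega, ?_⟩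
      rw [insMax_gt p σ p.1 le_rfl (by omega) h1, insMax_self]
      exact Fin.castSucc_lt_last _
  · obtain ⟨j, rfl⟩ : ∃ j, i = j + 1 := ⟨i - 1, by omega⟩
    have h3 : ¬ (j + 1 + 1 < p.1 ∧ j + 1 + 1 ∈ descSet n σ) := by omega
    have h4 : ¬ (j + 1 + 1 = p.1 + 1 ∧ p.1 < n) := by omega
    simp only [h3, h4, false_or, Nat.add_sub_cancel]
    rw [desc_succ]
    constructor
    · rintro ⟨h1, h2⟩
      rw [insMax_gt p σ (j+1) (by omega) (by omega) (by omega),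
        insMax_gt p σ j (by omega) (by omega) (by omega)] at h2
      exact ⟨by omega, by omega, h2⟩
    · rintro ⟨h0, h1, h2⟩
      refine ⟨by omega, ?_⟩
      rw [insMax_gt p σ (j+1) (by omega) (by omega) (by omega),
        insMax_gt p σ j (by omega) (by omega) (by omega)]
      exact h2

/-- number of permutations whose descent set is `J` apart from position `k`. -/
noncomputable def eCount (J : Finset ℕ) (k n : ℕ) : ℕ :=
  Nat.card {σ : Equiv.Perm (Fin n) // (descSet n σ).erase k = J}

lemma desc_last {n : ℕ} (I : Finset ℕ) (σ : Equiv.Perm (Fin n)) :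
    descSet (n + 1) (insMax (Fin.last n) σ) = I ↔ descSet n σ = I := by
  have : descSet (n + 1) (insMax (Fin.last n) σ) = descSet n σ := by
    ext x
    rw [desc_insMax]
    have := desc_lt n σ x
    have := desc_lt n σ (x - 1)
    simp only [Fin.val_last]
    grind
  rw [this]

lemma desc_cast {n : ℕ} (I : Finset ℕ) (hpos : ∀ i ∈ I, 0 < i) (p : Fin n)
    (σ : Equiv.Perm (Fin n)) :
    descSet (n + 1) (insMax p.castSucc σ) = I ↔
      p.1 + 1 ∈ Iprime I ∧ (descSet n σ).erase p.1 = Ihat I (p.1 + 1) := by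
  have hp := p.2
  have h0 := desc_zero n σ
  have key := desc_insMax p.castSucc σ
  simp only [Fin.val_castSucc, hp, and_true] at key
  constructor
  · rintro rfl
    constructor
    · simp only [Iprime, Finset.mem_filter, key]
      simp
    · ext x
      simp only [Ihat, Finset.mem_union, Finset.mem_filter, Finset.mem_image, Finset.mem_erase, key]
      constructor
      · rintro ⟨h1, h2⟩
        rcases lt_or_gt_of_ne h1 with h | h
        · left; exact ⟨Or.inl ⟨h, h2⟩, by omega⟩
        · right; exact ⟨x + 1, ⟨Or.inr (Or.inr ⟨by omega, by simpa using h2⟩), by omega⟩, by omega⟩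
      · grind
  · rintro ⟨h1, h2⟩
    simp only [Iprime, Finset.mem_filter, Nat.add_sub_cancel] at h1
    have h3 : ∀ x, (x ≠ p.1 ∧ x ∈ descSet n σ) ↔
        ((x ∈ I ∧ x < p.1 + 1) ∨ (x + 1 ∈ I ∧ p.1 + 1 < x + 1)) := by
      intro x
      rw [← Finset.mem_erase, h2]
      simp only [Ihat, Finset.mem_union, Finset.mem_filter, Finset.mem_image]
      apply or_congr Iff.rfl
      constructor
      · rintro ⟨a, ⟨h4, h5⟩, h6⟩
        obtain rfl : a = x + 1 := by omega
        exact ⟨h4, h5⟩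
      · rintro ⟨h4, h5⟩
        exact ⟨x + 1, ⟨h4, h5⟩, by omega⟩
    ext x
    rw [key]
    have := h3 x
    have := h3 (x - 1)
    have := hpos x
    rcases lt_trichotomy x (p.1 + 1) with h | h | h
    · grind
    · grind
    · have e : x - 1 + 1 = x := by omega
      grind

lemma recur (I : Finset ℕ) (hpos : ∀ i ∈ I, 0 < i) (n : ℕ) (hn : ∀ i ∈ I, i ≤ n) :
    dCount I (n + 1) = dCount I n + ∑ a ∈ Iprime I, eCount (Ihat I a) (a - 1) n := by
  classical
  have h1 : dCount I (n + 1) = ∑ p : Fin (n + 1),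
      Nat.card {σ : Equiv.Perm (Fin n) // descSet (n + 1) (insMax p σ) = I} := by
    rw [← Nat.card_sigma]
    unfold dCount
    symm
    refine Nat.card_congr (Equiv.ofBijective
      (fun x => ⟨insMax x.1 x.2.1, x.2.2⟩) ⟨?_, ?_⟩)
    · rintro ⟨p, σ, hσ⟩ ⟨q, τ, hτ⟩ h
      have h' := (insMax_bij n).1 (a₁ := (p, σ)) (a₂ := (q, τ)) (congrArg Subtype.val h)
      obtain ⟨rfl, rfl⟩ := Prod.mk.inj h'
      rfl
    · rintro ⟨π, hπ⟩
      obtain ⟨⟨p, σ⟩, h⟩ := (insMax_bij n).2 π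
      simp only at h
      subst h
      exact ⟨⟨p, σ, hπ⟩, rfl⟩
  rw [h1, Fin.sum_univ_castSucc, add_comm]
  congr 1
  · simp only [desc_last, dCount]
  · simp only [desc_cast I hpos]
    have h2 : ∀ p : Fin n, Nat.card {σ : Equiv.Perm (Fin n) // p.1 + 1 ∈ Iprime I ∧
        (descSet n σ).erase p.1 = Ihat I (p.1 + 1)} =
        if p.1 + 1 ∈ Iprime I then eCount (Ihat I (p.1 + 1)) p.1 n else 0 := by
      intro p
      split_ifs with h
      · simp [h, eCount]
      · simp [h]
    rw [Finset.sum_congr rfl (fun p _ => h2 p),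
      Fin.sum_univ_eq_sum_range
        (fun i => if i + 1 ∈ Iprime I then eCount (Ihat I (i + 1)) i n else 0) n,
      ← Finset.sum_filter]
    refine Finset.sum_bij (fun i _ => i + 1) ?_ ?_ ?_ ?_
    · intro a ha
      exact (Finset.mem_filter.mp ha).2
    · intro a _ b _ h
      omega
    · intro b hb
      have hbI : b ∈ I := (Finset.mem_filter.mp hb).1
      have := hpos b hbI
      have := hn b hbI
      refine ⟨b - 1, ?_, by omega⟩
      have e : b - 1 + 1 = b := by omega
      simp only [Finset.mem_filter, Finset.mem_range, e]
      exact ⟨by omega, hb⟩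
    · intro a ha
      rfl

lemma eCount_zero (J : Finset ℕ) (n : ℕ) : eCount J 0 n = dCount J n := by
  unfold eCount dCount
  simp only [Finset.erase_eq_of_notMem (desc_zero n _)]

lemma eCount_split (J : Finset ℕ) (k n : ℕ) (hk : k ∉ J) :
    eCount J k n = dCount (insert k J) n + dCount J n := by
  classical
  unfold eCount dCount
  simp only [Nat.card_eq_fintype_card, Fintype.card_subtype]
  rw [← Finset.card_union_of_disjoint]
  · congr 1
    ext σ
    simp only [Finset.mem_filter, Finset.mem_univ, true_and, Finset.mem_union]
    constructor
    · rintro rfl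
      by_cases h : k ∈ descSet n σ
      · left; rw [Finset.insert_erase h]
      · right; rw [Finset.erase_eq_of_notMem h]
    · rintro (h | h)
      · rw [h, Finset.erase_insert hk]
      · rw [h, Finset.erase_eq_of_notMem hk]
  · rw [Finset.disjoint_filter]
    intro σ _ h1 h2
    apply hk
    rw [← h2, h1]
    simp

/-- Gluing a subset and a permutation of the first `k` letters. -/
def glue {k l : ℕ} (S : {S : Finset (Fin (k + l)) // S.card = k ∧ Sᶜ.card = l})
    (τ : Equiv.Perm (Fin k)) : Equiv.Perm (Fin (k + l)) :=
  finSumFinEquiv.symm.trans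
    ((Equiv.sumCongr τ (Equiv.refl _)).trans (finSumEquivOfFinset S.2.1 S.2.2))

lemma glue_left {k l : ℕ} (S : {S : Finset (Fin (k + l)) // S.card = k ∧ Sᶜ.card = l})
    (τ : Equiv.Perm (Fin k)) (i : Fin k) :
    glue S τ (Fin.castAdd l i) = S.1.orderEmbOfFin S.2.1 (τ i) := by
  simp [glue]

lemma glue_right {k l : ℕ} (S : {S : Finset (Fin (k + l)) // S.card = k ∧ Sᶜ.card = l})
    (τ : Equiv.Perm (Fin k)) (i : Fin l) :
    glue S τ (Fin.natAdd k i) = S.1ᶜ.orderEmbOfFin S.2.2 i := by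
  simp [glue]

lemma glue_desc {k l : ℕ} (S : {S : Finset (Fin (k + l)) // S.card = k ∧ Sᶜ.card = l})
    (τ : Equiv.Perm (Fin k)) : (descSet (k + l) (glue S τ)).erase k = descSet k τ := by
  ext x
  obtain _ | i := x
  · simp [desc_zero]
  rw [Finset.mem_erase, desc_succ, desc_succ]
  rcases lt_trichotomy (i + 1) k with h | h | h
  · have e1 := glue_left S τ ⟨i, by omega⟩
    have e2 := glue_left S τ ⟨i + 1, h⟩
    simp only [Fin.castAdd_mk] at e1 e2
    constructor
    · rintro ⟨_, h1, h2⟩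
      rw [e1, e2] at h2
      exact ⟨h, by simpa using h2⟩
    · rintro ⟨h1, h2⟩
      refine ⟨by omega, by omega, ?_⟩
      rw [e1, e2]
      simpa using h2
  · constructor
    · rintro ⟨h1, _⟩; omega
    · rintro ⟨h1, _⟩; omega
  · constructor
    · rintro ⟨_, h1, h2⟩
      exfalso
      have e1 := glue_right S τ ⟨i - k, by omega⟩
      have e2 := glue_right S τ ⟨i + 1 - k, by omega⟩
      have f1 : Fin.natAdd k (⟨i - k, by omega⟩ : Fin l) = ⟨i, by omega⟩ := by
        ext; simp; omega
      have f2 : Fin.natAdd k (⟨i + 1 - k, by omega⟩ : Fin l) = ⟨i + 1, by omega⟩ := by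
        ext; simp; omega
      rw [f1] at e1
      rw [f2] at e2
      rw [e1, e2] at h2
      simp at h2
      omega
    · rintro ⟨h1, _⟩; omega

lemma glue_image {k l : ℕ} (S : {S : Finset (Fin (k + l)) // S.card = k ∧ Sᶜ.card = l})
    (τ : Equiv.Perm (Fin k)) :
    S.1 = Finset.univ.image (fun i => glue S τ (Fin.castAdd l i)) := by
  symm
  apply Finset.eq_of_subset_of_card_le
  · intro x hx
    simp only [Finset.mem_image, Finset.mem_univ, true_and] at hx
    obtain ⟨i, rfl⟩ := hx
    rw [glue_left]
    exact Finset.orderEmbOfFin_mem _ _ _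
  · rw [Finset.card_image_of_injective, S.2.1]
    · simp
    · intro a b h
      simpa using h

lemma glue_inj {k l : ℕ} (S T : {S : Finset (Fin (k + l)) // S.card = k ∧ Sᶜ.card = l})
    (τ ρ : Equiv.Perm (Fin k)) (h : glue S τ = glue T ρ) : S = T ∧ τ = ρ := by
  have hS : S = T := by
    apply Subtype.ext
    rw [glue_image S τ, glue_image T ρ, h]
  subst hS
  refine ⟨rfl, ?_⟩
  ext i
  have h1 := glue_left S τ i
  rw [h, glue_left] at h1
  have := (S.1.orderEmbOfFin S.2.1).injective h1
  rw [this]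

lemma glue_surj {k l : ℕ} (σ : Equiv.Perm (Fin (k + l)))
    (hσ : ∀ x ∈ descSet (k + l) σ, x ≤ k) :
    ∃ S τ, glue (k := k) (l := l) S τ = σ := by
  set S : Finset (Fin (k + l)) := Finset.univ.image (fun i => σ (Fin.castAdd l i)) with hS
  have hc : S.card = k := by
    rw [hS, Finset.card_image_of_injective]
    · simp
    · intro a b h
      simpa using h
  have hcc : Sᶜ.card = l := by
    rw [Finset.card_compl, hc]; simp
  have hr : (fun j : Fin l => σ (Fin.natAdd k j)) = Sᶜ.orderEmbOfFin hcc := by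
    apply Finset.orderEmbOfFin_unique
    · intro j
      simp only [hS, Finset.mem_compl, Finset.mem_image, Finset.mem_univ, true_and, not_exists]
      intro i h
      have := congrArg Fin.val (σ.injective h)
      simp at this
      omega
    · obtain _ | l := l
      · intro a; exact a.elim0
      rw [Fin.strictMono_iff_lt_succ]
      intro j
      by_contra hcon
      have hne : σ (Fin.natAdd k j.castSucc) ≠ σ (Fin.natAdd k j.succ) := by
        intro h
        have := congrArg Fin.val (σ.injective h)
        simp at this
      have hlt : σ (Fin.natAdd k j.succ) < σ (Fin.natAdd k j.castSucc) :=
        lt_of_le_of_ne (not_lt.mp hcon) hne.symm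
      have := hσ (k + j.1 + 1) ((desc_succ _ _ _).mpr ⟨by omega, hlt⟩)
      omega
  have hl : ∀ i : Fin k, ∃ j : Fin k, S.orderEmbOfFin hc j = σ (Fin.castAdd l i) := by
    intro i
    have : σ (Fin.castAdd l i) ∈ Set.range (S.orderEmbOfFin hc) := by
      rw [Finset.range_orderEmbOfFin]
      simp [hS]
    exact this
  choose f hf using hl
  have hfi : Function.Injective f := by
    intro a b h
    have h1 := hf a
    rw [h, hf b] at h1
    simpa using h1.symm
  refine ⟨⟨S, hc, hcc⟩, Equiv.ofBijective f (Finite.injective_iff_bijective.mp hfi), ?_⟩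
  apply Equiv.ext
  intro x
  induction x using Fin.addCases with
  | left i => rw [glue_left]; simp [hf]
  | right j => rw [glue_right]; exact (congrFun hr j).symm

lemma eCount_choose (J : Finset ℕ) (k n : ℕ) (hJ : ∀ x ∈ J, x < k) (hk : k ≤ n) :
    eCount J k n = dCount J k * n.choose k := by
  classical
  obtain ⟨l, rfl⟩ := Nat.exists_eq_add_of_le hk
  have hcard : Nat.card {S : Finset (Fin (k + l)) // S.card = k ∧ Sᶜ.card = l}
      = (k + l).choose k := by
    have : ∀ S : Finset (Fin (k + l)), (S.card = k ∧ Sᶜ.card = l) ↔ S.card = k := by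
      intro S
      rw [Finset.card_compl]
      simp only [Fintype.card_fin]
      omega
    simp only [this]
    rw [Nat.card_eq_fintype_card, Fintype.card_finset_len, Fintype.card_fin]
  rw [← hcard, mul_comm]
  unfold eCount dCount
  rw [← Nat.card_prod]
  symm
  refine Nat.card_congr (Equiv.ofBijective
    (fun q => ⟨glue q.1 q.2.1, by rw [glue_desc]; exact q.2.2⟩) ⟨?_, ?_⟩)
  · rintro ⟨S, τ⟩ ⟨T, ρ⟩ h
    obtain ⟨h1, h2⟩ := glue_inj S T τ.1 ρ.1 (congrArg Subtype.val h)
    rw [h1, Subtype.ext h2]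
  · rintro ⟨σ, hσ⟩
    obtain ⟨S, τ, h⟩ := glue_surj σ (by
      intro x hx
      by_contra hcon
      have : x ∈ J := by
        rw [← hσ, Finset.mem_erase]
        exact ⟨by omega, hx⟩
      have := hJ x this
      omega)
    refine ⟨⟨S, τ, ?_⟩, ?_⟩
    · rw [← glue_desc S τ, h, hσ]
    · exact Subtype.ext h

theorem stmt1 (I : Finset ℕ) (hI : I.Nonempty) (hpos : ∀ i ∈ I, 0 < i) :
    ∀ n : ℕ, mI I ≤ n →
      dCount I (n + 1) =
        dCount I n
          + ∑ a ∈ (Iprime2 I).erase (mI I), dCount (Imod I a) n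
          + ∑ a ∈ (Iprime I).erase (mI I), dCount (Ihat I a) n
          + dCount (Isub I) (mI I - 1) * n.choose (mI I - 1) := by
  classical
  intro n hn
  have hle : ∀ i ∈ I, i ≤ mI I := fun i hi => Finset.le_sup (f := id) hi
  have hm : mI I ∈ I := by
    obtain ⟨i, hi, h⟩ := Finset.exists_mem_eq_sup I hI id
    unfold mI
    rw [h]
    exact hi
  have hm0 := hpos _ hm
  rw [recur I hpos n (fun i hi => (hle i hi).trans hn)]
  -- the top term
  have htop : ∑ a ∈ Iprime I, eCount (Ihat I a) (a - 1) n =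
      ∑ a ∈ (Iprime I).erase (mI I), eCount (Ihat I a) (a - 1) n
        + dCount (Isub I) (mI I - 1) * n.choose (mI I - 1) := by
    by_cases h : mI I ∈ Iprime I
    · rw [← Finset.sum_erase_add _ _ h]
      congr 1
      have e : Ihat I (mI I) = Isub I := by
        ext x
        simp only [Ihat, Isub, Finset.mem_union, Finset.mem_filter, Finset.mem_image,
          Finset.mem_erase]
        grind
      rw [e]
      apply eCount_choose
      · intro x hx
        simp only [Isub, Finset.mem_erase] at hx
        simp only [Iprime, Finset.mem_filter] at h
        have := hle x hx.2
        have : x ≠ mI I - 1 := by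
          rintro rfl
          exact h.2 hx.2
        omega
      · omega
    · rw [Finset.erase_eq_of_notMem h]
      have h1 : mI I - 1 ∈ I := by
        by_contra h1
        exact h (Finset.mem_filter.mpr ⟨hm, h1⟩)
      have h2 : dCount (Isub I) (mI I - 1) = 0 := by
        unfold dCount
        have : IsEmpty {π : Equiv.Perm (Fin (mI I - 1)) // descSet (mI I - 1) π = Isub I} := by
          constructor
          rintro ⟨π, hπ⟩
          have := desc_lt _ π (mI I - 1) (by
            rw [hπ, Isub, Finset.mem_erase]
            exact ⟨by omega, h1⟩)
          omega
        exact Nat.card_of_isEmpty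
      rw [h2]; simp
  have hrest : ∑ a ∈ (Iprime I).erase (mI I), eCount (Ihat I a) (a - 1) n =
      ∑ a ∈ (Iprime2 I).erase (mI I), dCount (Imod I a) n
          + ∑ a ∈ (Iprime I).erase (mI I), dCount (Ihat I a) n := by
    have e1 : (Iprime2 I).erase (mI I) = ((Iprime I).erase (mI I)).filter (fun a => a ≠ 1) := by
      ext x
      simp only [Iprime2, Finset.mem_erase, Finset.mem_filter]
      tauto
    rw [e1, Finset.sum_filter, ← Finset.sum_add_distrib]
    apply Finset.sum_congr rfl
    intro a ha
    simp only [Iprime, Finset.mem_erase, Finset.mem_filter] at ha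
    obtain ⟨ham, haI, ha1⟩ := ha
    have ha0 := hpos a haI
    split_ifs with h
    · have e2 : Imod I a = insert (a - 1) (Ihat I a) := by
        ext x
        simp only [Imod, Ihat, Finset.mem_union, Finset.mem_filter, Finset.mem_image,
          Finset.mem_erase, Finset.mem_insert]
        grind
      rw [e2]
      apply eCount_split
      simp only [Ihat, Finset.mem_union, Finset.mem_filter, Finset.mem_image]
      grind
    · obtain rfl : a = 1 := by omega
      simp [eCount_zero]
  rw [htop, hrest]
  ring
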